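/- Entropy dissipation identity for the multi-species nonlocal system. Let d ≥ 2, T > 0, ε > 0, N ≤ p positive integers, A = (α^{ki}) ∈ M_{p×N}(ℝ), and let ρ^1,…,ρ^N be nonnegative Schwartz functions with ∫ρ^i = 1. Set ρ^i_ε(x) = ε^{−d}ρ^i(x/ε) and K^{ij}_ε = Σ_{k=1}^p α^{ki} α^{kj} (ρ̌^i_ε * ρ^j_ε). Let u^1,…,u^N : [0,T]×ℝ^d → (0,∞) be strictly positive classical solutions of ∂_t u^i = div( u^i Σ_{j=1}^N ∇(K^{ij}_ε * u^j) ), jointly smooth with each u^i(t,·) and all its spatial derivatives Schwartz locally uniformly in t, and with u^i ln u^i and |x|² u^i integrable in x locally uniformly in t. Then for every t ∈ [0,T]: Σ_{i=1}^N ∫_{ℝ^d} u^i(t,x) ln u^i(t,x) dx + Σ_{k=1}^p ∫_0^t ∫_{ℝ^d} ( Σ_{i=1}^N α^{ki} ∇(ρ^i_ε*u^i)(s,x) )² dx ds = Σ_{i=1}^N ∫_{ℝ^d} u^i(0,x) ln u^i(0,x) dx, where the square of the vector Σ_i α^{ki} ∇(ρ^i_ε*u^i) denotes its squared Euclidean norm.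 -/

import Mathlib

open MeasureTheory Real Set ENNReal RealInnerProductSpace Filter

noncomputable section

/-- `ℝ^d` as a Euclidean space. -/
abbrev Rd (d : ℕ) := EuclideanSpace ℝ (Fin d)

/-- Convolution of two real-valued functions on `ℝ^d`. -/
def conv {d : ℕ} (f g : Rd d → ℝ) : Rd d → ℝ := fun x => ∫ y, f (x - y) * g y

/-- Rescaled kernel `ρ_ε(x) = ε^{-d} ρ(x/ε)`. -/
def resc {d : ℕ} (ε : ℝ) (ρ : Rd d → ℝ) : Rd d → ℝ := fun x => (ε ^ d)⁻¹ * ρ (ε⁻¹ • x)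

/-- Reflection `ρ̌(x) = ρ(-x)`. -/
def refle {d : ℕ} (ρ : Rd d → ℝ) : Rd d → ℝ := fun x => ρ (-x)

/-- Spatial divergence of a vector field on `ℝ^d`. -/
def sdiv {d : ℕ} (F : Rd d → Rd d) (x : Rd d) : ℝ :=
  ∑ i : Fin d, fderiv ℝ (fun y => F y i) x (EuclideanSpace.single i (1:ℝ))

/-- Laplacian of a function on `ℝ^d`. -/
def slap {d : ℕ} (f : Rd d → ℝ) (x : Rd d) : ℝ :=
  ∑ i : Fin d, fderiv ℝ (fun y => fderiv ℝ f y (EuclideanSpace.single i (1:ℝ))) x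
    (EuclideanSpace.single i (1:ℝ))

/-- `u(t,·)` and all its spatial derivatives are Schwartz, (locally) uniformly in `t ∈ [0,T]`. -/
def SchwartzUnif (T : ℝ) {d : ℕ} (u : ℝ → Rd d → ℝ) : Prop :=
  ∀ n k : ℕ, ∃ C : ℝ, ∀ t ∈ Icc (0:ℝ) T, ∀ x : Rd d,
    ‖x‖ ^ n * ‖iteratedFDeriv ℝ k (u t) x‖ ≤ C

/-- The interaction kernel `K^{ij} = Σ_k α^{ki} α^{kj} ρ̌^i * ρ^j`. -/
def Kker {d p N : ℕ} (A : Matrix (Fin p) (Fin N) ℝ) (ρ : Fin N → Rd d → ℝ)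
    (i j : Fin N) : Rd d → ℝ :=
  fun x => ∑ k : Fin p, A k i * A k j * conv (refle (ρ i)) (ρ j) x

/-- continuous, integrable, bounded -/
def Nice {d : ℕ} (a : Rd d → ℝ) : Prop :=
  Continuous a ∧ Integrable a ∧ ∃ C, ∀ x, |a x| ≤ C

lemma conv_eq_convolution {d : ℕ} (a b : Rd d → ℝ) :
    conv a b = MeasureTheory.convolution a b (ContinuousLinearMap.mul ℝ ℝ) volume := by
  funext x
  rw [convolution_mul_swap]; rfl

lemma conv_apply' {d : ℕ} (a b : Rd d → ℝ) (x : Rd d) :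
    conv a b x = ∫ y, a y * b (x - y) := by
  rw [conv_eq_convolution, convolution_mul]

lemma Nice.integrable_conv {d : ℕ} {a b : Rd d → ℝ} (ha : Integrable a)
    (hb : Continuous b) {C : ℝ} (hC : ∀ x, |b x| ≤ C) (x : Rd d) :
    Integrable (fun y => a y * b (x - y)) := by
  refine ha.mul_bdd (c := C) ?_ (ae_of_all _ fun y => hC _)
  exact (hb.comp (by fun_prop)).aestronglyMeasurable

lemma conv_bound {d : ℕ} {a b : Rd d → ℝ} (ha : Integrable a)
    {C : ℝ} (hC : ∀ x, |b x| ≤ C) (x : Rd d) :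
    |conv a b x| ≤ (∫ y, |a y|) * C := by
  rw [conv_apply', ← integral_mul_const, ← Real.norm_eq_abs]
  refine norm_integral_le_of_norm_le (ha.abs.mul_const C) (ae_of_all _ fun y => ?_)
  rw [norm_mul]
  exact mul_le_mul_of_nonneg_left (hC _) (abs_nonneg _)

lemma Nice.conv {d : ℕ} {a b : Rd d → ℝ} (ha : Nice a) (hb : Nice b) : Nice (conv a b) := by
  obtain ⟨C, hC⟩ := hb.2.2
  refine ⟨?_, ?_, ⟨_, conv_bound ha.2.1 hC⟩⟩
  · rw [conv_eq_convolution]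
    refine BddAbove.continuous_convolution_right_of_integrable _ ?_ ha.2.1 hb.1
    exact ⟨C, by rintro _ ⟨x, rfl⟩; exact hC x⟩
  · rw [conv_eq_convolution]
    exact ha.2.1.integrable_convolution _ hb.2.1

lemma Nice.refle {d : ℕ} {a : Rd d → ℝ} (ha : Nice a) : Nice (refle a) := by
  obtain ⟨C, hC⟩ := ha.2.2
  exact ⟨ha.1.comp continuous_neg, ha.2.1.comp_neg, ⟨C, fun x => hC _⟩⟩

lemma Nice.abs {d : ℕ} {a : Rd d → ℝ} (ha : Nice a) : Nice (fun x => ‖a x‖) := by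
  obtain ⟨C, hC⟩ := ha.2.2
  exact ⟨ha.1.norm, ha.2.1.norm, ⟨C, fun x => by simpa using hC x⟩⟩

lemma Nice.const_mul {d : ℕ} {a : Rd d → ℝ} (ha : Nice a) (c : ℝ) : Nice (fun x => c * a x) := by
  obtain ⟨C, hC⟩ := ha.2.2
  refine ⟨continuous_const.mul ha.1, ha.2.1.const_mul c, ⟨|c| * C, fun x => ?_⟩⟩
  rw [abs_mul]
  exact mul_le_mul_of_nonneg_left (hC _) (abs_nonneg _)

lemma Nice.sum {d : ℕ} {ι : Type*} [Fintype ι] {a : ι → Rd d → ℝ} (ha : ∀ i, Nice (a i)) :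
    Nice (fun x => ∑ i, a i x) := by
  choose C hC using fun i => (ha i).2.2
  refine ⟨continuous_finsetSum _ fun i _ => (ha i).1, integrable_finsetSum _ fun i _ => (ha i).2.1,
    ⟨∑ i, C i, fun x => ?_⟩⟩
  exact (Finset.abs_sum_le_sum_abs _ _).trans (Finset.sum_le_sum fun i _ => hC i x)

lemma Nice.resc {d : ℕ} {ε : ℝ} (hε : 0 < ε) (S : SchwartzMap (Rd d) ℝ) : Nice (resc ε ⇑S) := by
  have h : Nice (fun x : Rd d => S (ε⁻¹ • x)) := by
    refine ⟨S.continuous.comp (by fun_prop), S.integrable.comp_smul (by positivity), ?_⟩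
    obtain ⟨C, hC⟩ := S.decay' 0 0
    exact ⟨C, fun x => by
      have := hC (ε⁻¹ • x)
      simp at this
      exact this⟩
  exact h.const_mul _

lemma Nice.mul {d : ℕ} {a b : Rd d → ℝ} (ha : Nice a) (hb : Nice b) :
    Integrable (fun x => a x * b x) := by
  obtain ⟨C, hC⟩ := hb.2.2
  exact ha.2.1.mul_bdd (c := C) hb.1.aestronglyMeasurable (ae_of_all _ hC)

lemma Nice.Kker {d p N : ℕ} (A : Matrix (Fin p) (Fin N) ℝ) {r : Fin N → Rd d → ℝ}
    (hr : ∀ i, Nice (r i)) (i j : Fin N) : Nice (Kker A r i j) :=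
  Nice.sum fun _ => ((hr i).refle.conv (hr j)).const_mul _

lemma Nice.exists_at {d : ℕ} {a b : Rd d → ℝ} (ha : Nice a) (hb : Nice b) (x : Rd d) :
    ConvolutionExistsAt a b x (ContinuousLinearMap.mul ℝ ℝ) volume := by
  obtain ⟨C, hC⟩ := hb.2.2
  exact Nice.integrable_conv ha.2.1 hb.1 hC x

lemma conv_assoc' {d : ℕ} {a b c : Rd d → ℝ} (ha : Nice a) (hb : Nice b) (hc : Nice c) :
    conv (conv a b) c = conv a (conv b c) := by
  funext x
  simp only [conv_eq_convolution]
  refine convolution_assoc _ _ _ _ (fun x y z => by simp [mul_assoc]) ha.1.aestronglyMeasurable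
    hb.1.aestronglyMeasurable hc.1.aestronglyMeasurable (ae_of_all _ (ha.exists_at hb))
    (ae_of_all _ (hb.abs.exists_at hc.abs)) ?_
  have := hb.abs.conv hc.abs
  rw [conv_eq_convolution] at this
  exact ha.abs.exists_at this x

lemma conv_adj {d : ℕ} {a g h : Rd d → ℝ} (ha : Nice a) (hg : Nice g) (hh : Nice h) :
    ∫ x, g x * conv (refle a) h x = ∫ x, conv a g x * h x := by
  obtain ⟨C, hC⟩ := ha.2.2
  have key : Integrable (fun q : Rd d × Rd d => a (q.2 - q.1) * (g q.1 * h q.2))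
      (volume.prod volume) := by
    refine (hg.2.1.mul_prod hh.2.1).bdd_mul (c := C) ?_ (ae_of_all _ fun q => hC _)
    exact (ha.1.comp (by fun_prop)).aestronglyMeasurable
  calc ∫ x, g x * conv (refle a) h x = ∫ x, ∫ y, a (y - x) * (g x * h y) := by
        congr 1; funext x
        rw [conv, ← integral_const_mul]
        congr 1; funext y
        simp only [refle, neg_sub]; ring
    _ = ∫ y, ∫ x, a (y - x) * (g x * h y) := integral_integral_swap key
    _ = _ := by
        congr 1; funext y
        rw [conv, ← integral_mul_const]
        congr 1; funext x
        ring

/-- m-th partial derivative -/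
def pd {d : ℕ} (m : Fin d) (f : Rd d → ℝ) (x : Rd d) : ℝ :=
  fderiv ℝ f x (EuclideanSpace.single m (1:ℝ))

lemma norm_sgl {d : ℕ} (m : Fin d) : ‖(EuclideanSpace.single m (1:ℝ) : Rd d)‖ = 1 := by simp

lemma grad_apply {d : ℕ} (f : Rd d → ℝ) (x : Rd d) (m : Fin d) :
    gradient f x m = pd m f x := by
  have : inner ℝ (gradient f x) (EuclideanSpace.single m (1:ℝ) : Rd d) = pd m f x := by
    rw [gradient, InnerProductSpace.toDual_symm_apply]; rfl
  rw [← this, EuclideanSpace.inner_single_right]; simp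

lemma conv_hasFDerivAt {d : ℕ} {K f : Rd d → ℝ} (hK : Integrable K) (hf : ContDiff ℝ 1 f)
    {C0 C1 : ℝ} (h0 : ∀ x, |f x| ≤ C0) (h1 : ∀ x, ‖fderiv ℝ f x‖ ≤ C1) (x : Rd d) :
    HasFDerivAt (conv K f) (∫ y, K y • fderiv ℝ f (x - y)) x := by
  have e : conv K f = fun x => ∫ y, K y * f (x - y) := funext (conv_apply' K f)
  have hc := hf.continuous_fderiv one_ne_zero
  rw [e]
  refine hasFDerivAt_integral_of_dominated_of_fderiv_le (bound := fun y => |K y| * C1)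
    (F' := fun x y => K y • fderiv ℝ f (x - y)) univ_mem
    (Eventually.of_forall fun z => (Nice.integrable_conv hK hf.continuous h0 z).aestronglyMeasurable)
    (Nice.integrable_conv hK hf.continuous h0 x) ?_ ?_ (hK.abs.mul_const _) ?_
  · exact hK.aestronglyMeasurable.smul (hc.comp (by fun_prop)).aestronglyMeasurable
  · refine ae_of_all _ fun y z _ => ?_
    rw [norm_smul]
    exact mul_le_mul_of_nonneg_left (h1 _) (abs_nonneg _)
  · refine ae_of_all _ fun y z _ => ?_
    have h2 : HasFDerivAt f (fderiv ℝ f (z - y)) (z - y) :=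
      (hf.differentiable one_ne_zero _).hasFDerivAt
    have h3 : HasFDerivAt (fun z => f (z - y)) (fderiv ℝ f (z - y)) z := by
      have := h2.comp z ((hasFDerivAt_id z).sub_const y)
      simpa [Function.comp_def] using this
    exact h3.const_mul (K y)

lemma conv_pd {d : ℕ} {K f : Rd d → ℝ} (hK : Integrable K) (hf : ContDiff ℝ 1 f)
    {C0 C1 : ℝ} (h0 : ∀ x, |f x| ≤ C0) (h1 : ∀ x, ‖fderiv ℝ f x‖ ≤ C1) (m : Fin d) :
    pd m (conv K f) = conv K (pd m f) := by
  funext x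
  have hc := hf.continuous_fderiv one_ne_zero
  rw [pd, (conv_hasFDerivAt hK hf h0 h1 x).fderiv, conv_apply',
    ContinuousLinearMap.integral_apply]
  · rfl
  · refine (hK.abs.mul_const C1).mono'
      (hK.aestronglyMeasurable.smul (hc.comp (by fun_prop)).aestronglyMeasurable)
      (ae_of_all _ fun y => ?_)
    rw [norm_smul]
    exact mul_le_mul_of_nonneg_left (h1 _) (abs_nonneg _)

lemma pd_bound {d : ℕ} (m : Fin d) (f : Rd d → ℝ) (x : Rd d) : |pd m f x| ≤ ‖fderiv ℝ f x‖ := by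
  have := (fderiv ℝ f x).le_opNorm (EuclideanSpace.single m (1:ℝ))
  rwa [norm_sgl, mul_one] at this

lemma pd_contDiff {d : ℕ} (m : Fin d) {f : Rd d → ℝ} (hf : ContDiff ℝ 2 f) :
    ContDiff ℝ 1 (pd m f) :=
  (hf.fderiv_right (m := 1) (by norm_num)).clm_apply contDiff_const

lemma fderiv_pd_bound {d : ℕ} (m : Fin d) {f : Rd d → ℝ} (hf : ContDiff ℝ 2 f) (x : Rd d) :
    ‖fderiv ℝ (pd m f) x‖ ≤ ‖fderiv ℝ (fderiv ℝ f) x‖ := by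
  have h1 : HasFDerivAt (fderiv ℝ f) (fderiv ℝ (fderiv ℝ f) x) x :=
    ((hf.fderiv_right (m := 1) (by norm_num)).differentiable one_ne_zero x).hasFDerivAt
  have h2 := h1.clm_apply (hasFDerivAt_const (EuclideanSpace.single m (1:ℝ) : Rd d) x)
  have h3 : fderiv ℝ (pd m f) x = _ := h2.fderiv
  rw [h3]
  refine ContinuousLinearMap.opNorm_le_bound _ (by positivity) fun v => ?_
  simp only [ContinuousLinearMap.add_apply, ContinuousLinearMap.comp_apply,
    ContinuousLinearMap.zero_apply, map_zero, zero_add, ContinuousLinearMap.flip_apply]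
  have := (fderiv ℝ (fderiv ℝ f) x).le_opNorm₂ v (EuclideanSpace.single m (1:ℝ))
  rwa [norm_sgl, mul_one] at this

lemma sq_grad {d : ℕ} (m : Fin d) {f : Rd d → ℝ} (hf : ContDiff ℝ 2 f) (h0 : ∀ x, 0 ≤ f x)
    {M : ℝ} (hM : 0 < M) (h2 : ∀ x, ‖fderiv ℝ (fderiv ℝ f) x‖ ≤ M) (x : Rd d) :
    (pd m f x) ^ 2 ≤ 4 * M * f x := by
  have hd : Differentiable ℝ f := hf.differentiable two_ne_zero
  have hd2 : Differentiable ℝ (fderiv ℝ f) :=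
    (hf.fderiv_right (m := 1) (by norm_num)).differentiable one_ne_zero
  set g := pd m f x with hg
  set r : ℝ := -g / (2 * M) with hr
  set y : Rd d := x + r • EuclideanSpace.single m (1:ℝ) with hy
  have hyx : ‖y - x‖ = |r| := by
    rw [hy, add_sub_cancel_left, norm_smul, norm_sgl, mul_one, Real.norm_eq_abs]
  have hlip : ∀ z ∈ Metric.closedBall x |r|, ‖fderiv ℝ f z - fderiv ℝ f x‖ ≤ M * |r| := by
    intro z hz
    have := convex_univ.norm_image_sub_le_of_norm_fderiv_le (𝕜 := ℝ) (f := fderiv ℝ f) (C := M)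
      (fun w _ => hd2 w) (fun w _ => h2 w) (mem_univ x) (mem_univ z)
    refine this.trans (mul_le_mul_of_nonneg_left ?_ hM.le)
    rwa [← mem_closedBall_iff_norm]
  have hT := (convex_closedBall x |r|).norm_image_sub_le_of_norm_fderiv_le' (𝕜 := ℝ) (f := f)
    (φ := fderiv ℝ f x) (fun w _ => hd w) hlip (Metric.mem_closedBall_self (abs_nonneg r))
    (mem_closedBall_iff_norm.2 hyx.le)
  rw [hyx] at hT
  have e : fderiv ℝ f x (y - x) = r * g := by
    rw [hy, add_sub_cancel_left, map_smul, smul_eq_mul]; rfl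
  rw [e, Real.norm_eq_abs] at hT
  have h3 := (abs_le.1 hT).2
  have h4 : M * |r| * |r| = M * r ^ 2 := by rw [mul_assoc, abs_mul_abs_self]; ring
  rw [h4] at h3
  have h5 := h0 y
  have h6 : r * g + M * r ^ 2 = - g ^ 2 / (4 * M) := by
    rw [hr]; field_simp; ring
  have h7 : g ^ 2 / (4 * M) ≤ f x := by
    have : - g ^ 2 / (4 * M) = - (g ^ 2 / (4 * M)) := by ring
    linarith
  rw [div_le_iff₀ (by positivity)] at h7
  linarith

/-- integrable weight -/
def Bw (d : ℕ) (x : Rd d) : ℝ := ((1 + ‖x‖) ^ (d + 1))⁻¹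

lemma Bw_pos {d : ℕ} (x : Rd d) : 0 < Bw d x := by unfold Bw; positivity

lemma Bw_int (d : ℕ) : Integrable (Bw d) := by
  have := integrable_one_add_norm (E := Rd d) (μ := volume) (r := (d:ℝ) + 1) (by simp)
  refine this.congr (ae_of_all _ fun x => ?_)
  simp only [Bw]
  rw [Real.rpow_neg (by positivity)]
  congr 1
  exact_mod_cast Real.rpow_natCast (1 + ‖x‖) (d + 1)

lemma schw_weight {d : ℕ} {T : ℝ} {u : ℝ → Rd d → ℝ} (hu : SchwartzUnif T u) (n k : ℕ) :
    ∃ C, 0 < C ∧ ∀ t ∈ Icc (0:ℝ) T, ∀ x,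
      ‖iteratedFDeriv ℝ k (u t) x‖ ≤ C * ((1 + ‖x‖) ^ n)⁻¹ := by
  obtain ⟨C0, h0⟩ := hu 0 k
  obtain ⟨C1, h1⟩ := hu n k
  refine ⟨2 ^ (n - 1) * (|C0| + |C1|) + 1, by positivity, fun t ht x => ?_⟩
  rw [← div_eq_mul_inv, le_div_iff₀ (by positivity)]
  have a0 := (h0 t ht x).trans (le_abs_self _)
  have a1 := (h1 t ht x).trans (le_abs_self _)
  have a2 := add_pow_le zero_le_one (norm_nonneg x) n
  have a3 := norm_nonneg (iteratedFDeriv ℝ k (u t) x)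
  rw [pow_zero, one_mul] at a0
  calc _ ≤ ‖iteratedFDeriv ℝ k (u t) x‖ * (2 ^ (n - 1) * (1 ^ n + ‖x‖ ^ n)) :=
        mul_le_mul_of_nonneg_left a2 a3
    _ = 2 ^ (n - 1) * (‖iteratedFDeriv ℝ k (u t) x‖ + ‖x‖ ^ n * ‖iteratedFDeriv ℝ k (u t) x‖) := by
        rw [one_pow]; ring
    _ ≤ 2 ^ (n - 1) * (|C0| + |C1|) := by gcongr
    _ ≤ _ := by linarith

lemma log_bound {v w M : ℝ} (hv : 0 < v) (hw : w = √(√v)) (hM : w ≤ M) (hM1 : 1 ≤ M) :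
    √v * (1 + |Real.log v|) ≤ (9 * M ^ 2) * w := by
  have hw0 : 0 < w := by rw [hw]; positivity
  have hs : √v = w ^ 2 := by rw [hw, Real.sq_sqrt (by positivity)]
  have hv4 : v = w ^ 4 := by
    have : v = (√v) ^ 2 := (Real.sq_sqrt hv.le).symm
    rw [this, hs]; ring
  have hl : Real.log v = 4 * Real.log w := by rw [hv4, Real.log_pow]; norm_num
  have l1 : Real.log w ≤ w := (Real.log_le_sub_one_of_pos hw0).trans (by linarith)
  have l2 : - Real.log w ≤ w⁻¹ := by
    rw [← Real.log_inv]
    exact (Real.log_le_sub_one_of_pos (inv_pos.2 hw0)).trans (by linarith)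
  have hi : 0 < w⁻¹ := inv_pos.2 hw0
  have l3 : |Real.log w| ≤ w + w⁻¹ := abs_le.2 ⟨by linarith, by linarith⟩
  have l4 : |Real.log v| ≤ 4 * (w + w⁻¹) := by
    rw [hl, abs_mul, abs_of_pos (by norm_num : (0:ℝ) < 4)]; linarith
  calc √v * (1 + |Real.log v|) ≤ w ^ 2 * (1 + 4 * (w + w⁻¹)) := by rw [hs]; gcongr
    _ = (w + 4 * w ^ 2 + 4) * w := by field_simp; ring
    _ ≤ _ := by
      refine mul_le_mul_of_nonneg_right ?_ hw0.le
      nlinarith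

/-- all the uniform bounds needed -/
structure UB {d : ℕ} (T M : ℝ) (u : ℝ → Rd d → ℝ) : Prop where
  one_le : 1 ≤ M
  b1 : ∀ t ∈ Icc (0:ℝ) T, ∀ x, |u t x| ≤ M
  b2 : ∀ t ∈ Icc (0:ℝ) T, ∀ x, ‖fderiv ℝ (u t) x‖ ≤ M
  b3 : ∀ t ∈ Icc (0:ℝ) T, ∀ x, ‖fderiv ℝ (fderiv ℝ (u t)) x‖ ≤ M
  b4 : ∀ t ∈ Icc (0:ℝ) T, ∀ x, ‖fderiv ℝ (u t) x‖ ≤ M * Bw d x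
  b5 : ∀ t ∈ Icc (0:ℝ) T, ∀ x, √(u t x) * (1 + |Real.log (u t x)|) ≤ M * Bw d x
  b6 : ∀ t ∈ Icc (0:ℝ) T, ∀ x, u t x ≤ M * √(u t x)
  b7 : ∀ t ∈ Icc (0:ℝ) T, ∀ x m, |pd m (u t) x| ≤ M * √(u t x)

lemma UB.mono {d : ℕ} {T M M' : ℝ} {u : ℝ → Rd d → ℝ} (h : UB T M u) (hM : M ≤ M') :
    UB T M' u where
  one_le := h.one_le.trans hM
  b1 t ht x := (h.b1 t ht x).trans hM
  b2 t ht x := (h.b2 t ht x).trans hM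
  b3 t ht x := (h.b3 t ht x).trans hM
  b4 t ht x := (h.b4 t ht x).trans (mul_le_mul_of_nonneg_right hM (Bw_pos x).le)
  b5 t ht x := (h.b5 t ht x).trans (mul_le_mul_of_nonneg_right hM (Bw_pos x).le)
  b6 t ht x := (h.b6 t ht x).trans (mul_le_mul_of_nonneg_right hM (Real.sqrt_nonneg _))
  b7 t ht x m := (h.b7 t ht x m).trans (mul_le_mul_of_nonneg_right hM (Real.sqrt_nonneg _))

lemma exists_UB {d : ℕ} {T : ℝ} {u : ℝ → Rd d → ℝ} (hu : SchwartzUnif T u)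
    (hpos : ∀ t x, 0 < u t x) (hs : ∀ t, ContDiff ℝ 2 (u t)) : ∃ M, UB T M u := by
  obtain ⟨C0, p0, h0⟩ := schw_weight hu 0 0
  obtain ⟨C1, p1, h1⟩ := schw_weight hu 0 1
  obtain ⟨C2, p2, h2⟩ := schw_weight hu 0 2
  obtain ⟨C3, p3, h3⟩ := schw_weight hu (d + 1) 1
  obtain ⟨C4, p4, h4⟩ := schw_weight hu (4 * (d + 1)) 0
  simp only [pow_zero, inv_one, mul_one, norm_iteratedFDeriv_zero, norm_iteratedFDeriv_one,
    Real.norm_eq_abs] at h0 h1 h2 h3 h4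
  have h2' : ∀ t ∈ Icc (0:ℝ) T, ∀ x, ‖fderiv ℝ (fderiv ℝ (u t)) x‖ ≤ C2 := by
    intro t ht x
    rw [← norm_iteratedFDeriv_one, norm_iteratedFDeriv_fderiv]
    exact h2 t ht x
  have hw : ∀ t ∈ Icc (0:ℝ) T, ∀ x, √(√(u t x)) ≤ (C4 + 1) * Bw d x := by
    intro t ht x
    have hB := Bw_pos x
    rw [← pow_le_pow_iff_left₀ (Real.sqrt_nonneg _) (by positivity) (n := 4) (by norm_num)]
    have e : √(√(u t x)) ^ 4 = u t x := by
      have : √(√(u t x)) ^ 4 = (√(√(u t x)) ^ 2) ^ 2 := by ring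
      rw [this, Real.sq_sqrt (Real.sqrt_nonneg _), Real.sq_sqrt (hpos t x).le]
    have e2 : ((1 + ‖x‖) ^ (4 * (d + 1)))⁻¹ = Bw d x ^ 4 := by
      rw [Bw, inv_pow, ← pow_mul]; ring_nf
    rw [e, mul_pow, ← e2]
    refine (le_abs_self _).trans ((h4 t ht x).trans ?_)
    refine mul_le_mul_of_nonneg_right ?_ (by positivity)
    nlinarith [pow_pos p4 2, pow_pos p4 3, pow_pos p4 4]
  have hB1 : ∀ x : Rd d, Bw d x ≤ 1 := fun x =>
    inv_le_one_of_one_le₀ (one_le_pow₀ (by linarith [norm_nonneg x]))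
  have hsq : ∀ t ∈ Icc (0:ℝ) T, ∀ x, √(u t x) ≤ C0 + 1 := by
    intro t ht x
    rw [Real.sqrt_le_left (by positivity)]
    have := (le_abs_self _).trans (h0 t ht x)
    nlinarith
  have hC4 : (1:ℝ) ≤ C4 + 1 := by linarith
  have hC40 : (0:ℝ) ≤ 9 * (C4 + 1) ^ 3 := by positivity
  refine ⟨1 + C0 + C1 + 4 * C2 + 1 + C3 + 9 * (C4 + 1) ^ 3, by linarith, ?_, ?_, ?_, ?_, ?_, ?_, ?_⟩
  · intro t ht x; linarith [h0 t ht x]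
  · intro t ht x; linarith [h1 t ht x]
  · intro t ht x; linarith [h2' t ht x]
  · intro t ht x
    exact (h3 t ht x).trans (mul_le_mul_of_nonneg_right (by linarith) (Bw_pos x).le)
  · intro t ht x
    have hwM : √(√(u t x)) ≤ C4 + 1 := (hw t ht x).trans (by nlinarith [hB1 x])
    refine (log_bound (hpos t x) rfl hwM hC4).trans ?_
    calc _ ≤ 9 * (C4 + 1) ^ 2 * ((C4 + 1) * Bw d x) := by gcongr; exact hw t ht x
      _ = 9 * (C4 + 1) ^ 3 * Bw d x := by ring
      _ ≤ _ := mul_le_mul_of_nonneg_right (by linarith) (Bw_pos x).le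
  · intro t ht x
    calc u t x = √(u t x) * √(u t x) := (Real.mul_self_sqrt (hpos t x).le).symm
      _ ≤ _ := mul_le_mul_of_nonneg_right (by linarith [hsq t ht x]) (Real.sqrt_nonneg _)
  · intro t ht x m
    have := sq_grad m (hs t) (fun x => (hpos t x).le) p2 (h2' t ht) x
    refine abs_le_of_sq_le_sq ?_ (by positivity)
    rw [mul_pow, Real.sq_sqrt (hpos t x).le]
    refine this.trans (mul_le_mul_of_nonneg_right ?_ (hpos t x).le)
    nlinarith

lemma log_dom {d : ℕ} {T M : ℝ} {u : ℝ → Rd d → ℝ} (h : UB T M u) {t : ℝ} (ht : t ∈ Icc 0 T)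
    {x : Rd d} {D C : ℝ} (hC : 0 ≤ C) (hD : |D| ≤ C * √(u t x)) :
    |D * (Real.log (u t x) + 1)| ≤ C * M * Bw d x := by
  rw [abs_mul]
  have h1 : |Real.log (u t x) + 1| ≤ 1 + |Real.log (u t x)| := by
    refine (abs_add_le _ _).trans ?_
    rw [abs_one, add_comm]
  calc _ ≤ (C * √(u t x)) * (1 + |Real.log (u t x)|) := by gcongr
    _ = C * (√(u t x) * (1 + |Real.log (u t x)|)) := by ring
    _ ≤ C * (M * Bw d x) := mul_le_mul_of_nonneg_left (h.b5 t ht x) hC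
    _ = _ := by ring

lemma pd_mul {d : ℕ} (m : Fin d) {f V : Rd d → ℝ} (hf : Differentiable ℝ f)
    (hV : Differentiable ℝ V) (x : Rd d) :
    pd m (fun y => f y * V y) x = f x * pd m V x + pd m f x * V x := by
  rw [pd, fderiv_fun_mul (hf x) (hV x)]
  simp [pd, mul_comm]

lemma pd_mul_bound {d : ℕ} {T M C : ℝ} {u : ℝ → Rd d → ℝ} (h : UB T M u) {t : ℝ}
    (ht : t ∈ Icc 0 T) (hpos : ∀ t x, 0 < u t x)
    (hs : ContDiff ℝ 2 (u t)) (m : Fin d) {V : Rd d → ℝ}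
    (hV : Differentiable ℝ V) (h1 : ∀ x, |V x| ≤ C) (h2 : ∀ x, |pd m V x| ≤ C) (x : Rd d) :
    |pd m (fun y => u t y * V y) x| ≤ (2 * M * C) * √(u t x) := by
  rw [pd_mul m (hs.differentiable two_ne_zero) hV]
  have hM := h.one_le
  have hC : 0 ≤ C := (abs_nonneg _).trans (h1 x)
  refine (abs_add_le _ _).trans ?_
  rw [abs_mul, abs_mul, abs_of_pos (hpos t x)]
  calc _ ≤ (M * √(u t x)) * C + (M * √(u t x)) * C := by
        gcongr
        · exact h.b6 t ht x
        · exact h2 x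
        · exact h.b7 t ht x m
        · exact h1 x
    _ = _ := by ring

lemma ibp {d : ℕ} {T M C : ℝ} {u : ℝ → Rd d → ℝ} (h : UB T M u) {t : ℝ}
    (ht : t ∈ Icc 0 T) (hpos : ∀ t x, 0 < u t x)
    (hs : ContDiff ℝ 2 (u t)) (m : Fin d) {V : Rd d → ℝ}
    (hV : Differentiable ℝ V) (h1 : ∀ x, |V x| ≤ C) (h2 : ∀ x, |pd m V x| ≤ C) :
    Integrable (fun x => pd m (fun y => u t y * V y) x * (Real.log (u t x) + 1)) ∧
    ∫ x, pd m (fun y => u t y * V y) x * (Real.log (u t x) + 1) = - ∫ x, pd m (u t) x * V x := by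
  have hM := h.one_le
  have hC : 0 ≤ C := (abs_nonneg _).trans (h1 0)
  have hd := hs.differentiable two_ne_zero
  have hg : Differentiable ℝ (fun x => Real.log (u t x) + 1) := fun x =>
    ((hd x).log (hpos t x).ne').add_const 1
  have hgd : ∀ x, u t x * V x * fderiv ℝ (fun x => Real.log (u t x) + 1) x
      (EuclideanSpace.single m (1:ℝ)) = pd m (u t) x * V x := by
    intro x
    have : HasFDerivAt (fun x => Real.log (u t x) + 1) ((u t x)⁻¹ • fderiv ℝ (u t) x) x :=
      (((hd x).hasFDerivAt.log (hpos t x).ne').add_const 1)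
    rw [this.fderiv]
    have := (hpos t x).ne'
    simp only [smul_apply, smul_eq_mul, pd]
    field_simp
  have i1 : Integrable (fun x => pd m (fun y => u t y * V y) x * (Real.log (u t x) + 1)) := by
    refine ((Bw_int d).const_mul ((2 * M * C) * M)).mono' ?_ (ae_of_all _ fun x =>
      log_dom h ht (by positivity) (pd_mul_bound h ht hpos hs m hV h1 h2 x))
    exact ((measurable_fderiv_apply_const ℝ _ _).mul hg.continuous.measurable).aestronglyMeasurable
  have i2 : Integrable (fun x => pd m (u t) x * V x) := by
    refine ((Bw_int d).const_mul (M * C)).mono' ?_ (ae_of_all _ fun x => ?_)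
    · exact ((measurable_fderiv_apply_const ℝ _ _).mul
        hV.continuous.measurable).aestronglyMeasurable
    · rw [norm_mul, Real.norm_eq_abs, Real.norm_eq_abs]
      have hB := Bw_pos x
      calc _ ≤ (M * Bw d x) * C := by
            gcongr
            · exact (pd_bound m _ x).trans (h.b4 t ht x)
            · exact h1 x
        _ = _ := by ring
  have i3 : Integrable (fun x => u t x * V x * (Real.log (u t x) + 1)) := by
    refine ((Bw_int d).const_mul ((M * C) * M)).mono' ?_ (ae_of_all _ fun x => ?_)
    · exact ((hd.continuous.mul hV.continuous).mul hg.continuous).aestronglyMeasurable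
    · refine log_dom h ht (by positivity) ?_
      rw [abs_mul, abs_of_pos (hpos t x)]
      calc _ ≤ (M * √(u t x)) * C := by
            gcongr
            · exact h.b6 t ht x
            · exact h1 x
        _ = _ := by ring
  refine ⟨i1, ?_⟩
  have := integral_mul_fderiv_eq_neg_fderiv_mul_of_integrable (μ := (volume : Measure (Rd d)))
    (f := fun x => u t x * V x)
    (g := fun x => Real.log (u t x) + 1) (v := (EuclideanSpace.single m (1:ℝ) : Rd d)) i1
    (by simpa only [hgd] using i2) i3 (fun x _ => (hd x).mul (hV x)) (fun x _ => hg x)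
  simp only [hgd] at this
  rw [this, neg_neg]; rfl

lemma slice_contDiff {d : ℕ} {u : ℝ → Rd d → ℝ}
    (hU : ContDiff ℝ (⊤ : ℕ∞) (fun q : ℝ × Rd d => u q.1 q.2)) (t : ℝ) : ContDiff ℝ 2 (u t) := by
  have h : ContDiff ℝ 2 (fun q : ℝ × Rd d => u q.1 q.2) := hU.of_le (WithTop.coe_le_coe.2 le_top)
  exact h.comp (contDiff_const.prodMk contDiff_id)

lemma time_hasDerivAt {d : ℕ} {u : ℝ → Rd d → ℝ}
    (hU : ContDiff ℝ (⊤ : ℕ∞) (fun q : ℝ × Rd d => u q.1 q.2)) (t : ℝ) (x : Rd d) :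
    HasDerivAt (fun s => u s x) (fderiv ℝ (fun q : ℝ × Rd d => u q.1 q.2) (t, x) (1, 0)) t := by
  have h := (hU.differentiable (by simp) (t, x)).hasFDerivAt
  have h2 : HasDerivAt (fun s : ℝ => (s, x)) ((1 : ℝ), (0 : Rd d)) t :=
    (hasDerivAt_id t).prodMk (hasDerivAt_const t x)
  exact h.comp_hasDerivAt t h2

lemma time_deriv_cont {d : ℕ} {u : ℝ → Rd d → ℝ}
    (hU : ContDiff ℝ (⊤ : ℕ∞) (fun q : ℝ × Rd d => u q.1 q.2)) :
    Continuous (fun q : ℝ × Rd d => deriv (fun s => u s q.2) q.1) := by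
  have : (fun q : ℝ × Rd d => deriv (fun s => u s q.2) q.1) =
      fun q => fderiv ℝ (fun q : ℝ × Rd d => u q.1 q.2) q (1, 0) := by
    funext q; exact (time_hasDerivAt hU q.1 q.2).deriv
  rw [this]
  exact (hU.continuous_fderiv (by simp)).clm_apply continuous_const

lemma pd_cont {d : ℕ} {u : ℝ → Rd d → ℝ}
    (hU : ContDiff ℝ (⊤ : ℕ∞) (fun q : ℝ × Rd d => u q.1 q.2)) (m : Fin d) :
    Continuous (fun q : ℝ × Rd d => pd m (u q.1) q.2) := by
  have : (fun q : ℝ × Rd d => pd m (u q.1) q.2) =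
      fun q => fderiv ℝ (fun q : ℝ × Rd d => u q.1 q.2) q (0, EuclideanSpace.single m (1:ℝ)) := by
    funext q
    have h := (hU.differentiable (by simp) (q.1, q.2)).hasFDerivAt
    have h2 : HasFDerivAt (fun y : Rd d => (q.1, y)) (ContinuousLinearMap.inr ℝ ℝ (Rd d)) q.2 :=
      hasFDerivAt_prodMk_right q.1 q.2
    have h3 : HasFDerivAt (u q.1) _ q.2 := h.comp q.2 h2
    rw [pd, h3.fderiv]; simp
  rw [this]
  exact (hU.continuous_fderiv (by simp)).clm_apply continuous_const

lemma time_id {d : ℕ} {u : ℝ → Rd d → ℝ}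
    (hU : ContDiff ℝ (⊤ : ℕ∞) (fun q : ℝ × Rd d => u q.1 q.2)) (hpos : ∀ t x, 0 < u t x)
    {T C : ℝ}
    (hb : ∀ t ∈ Icc (0:ℝ) T, ∀ x,
      |deriv (fun s => u s x) t * (Real.log (u t x) + 1)| ≤ C * Bw d x)
    (hent : ∀ t ∈ Icc (0:ℝ) T, Integrable (fun x => u t x * Real.log (u t x)))
    {t : ℝ} (ht : t ∈ Icc (0:ℝ) T) :
    IntervalIntegrable (fun s => ∫ x, deriv (fun s => u s x) s * (Real.log (u s x) + 1))
      volume 0 t ∧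
    (∫ x, u t x * Real.log (u t x)) - ∫ x, u 0 x * Real.log (u 0 x) =
      ∫ s in (0:ℝ)..t, ∫ x, deriv (fun s => u s x) s * (Real.log (u s x) + 1) := by
  have hc : Continuous (fun q : ℝ × Rd d =>
      deriv (fun s => u s q.2) q.1 * (Real.log (u q.1 q.2) + 1)) :=
    (time_deriv_cont hU).mul ((hU.continuous.log fun q => (hpos _ _).ne').add continuous_const)
  have hI : Integrable (fun q : ℝ × Rd d =>
      deriv (fun s => u s q.2) q.1 * (Real.log (u q.1 q.2) + 1))
      ((volume.restrict (Ioc 0 t)).prod volume) := by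
    refine (((Bw_int d).const_mul C).comp_snd _).mono' hc.aestronglyMeasurable ?_
    have e : (volume.restrict (Ioc 0 t)).prod (volume : Measure (Rd d)) =
        ((volume : Measure ℝ).prod (volume : Measure (Rd d))).restrict (Ioc 0 t ×ˢ univ) := by
      rw [← Measure.prod_restrict, Measure.restrict_univ]
    rw [e]
    filter_upwards [ae_restrict_mem (measurableSet_Ioc.prod MeasurableSet.univ)] with q hq
    exact hb q.1 ⟨hq.1.1.le, hq.1.2.trans ht.2⟩ q.2
  constructor
  · rw [intervalIntegrable_iff_integrableOn_Ioc_of_le ht.1]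
    exact hI.integral_prod_left
  · rw [intervalIntegral.integral_of_le ht.1, integral_integral_swap hI,
      ← integral_sub (hent t ht) (hent 0 ⟨le_rfl, ht.1.trans ht.2⟩)]
    congr 1; funext x
    rw [← intervalIntegral.integral_of_le ht.1]
    symm
    refine intervalIntegral.integral_eq_sub_of_hasDerivAt
      (f := fun s => u s x * Real.log (u s x)) (fun s _ => ?_) ?_
    · have h := time_hasDerivAt hU s x
      have h2 := h.mul (h.log (hpos s x).ne')
      rw [h.deriv]
      refine h2.congr_deriv ?_
      have := (hpos s x).ne'
      field_simp
    · exact (hc.comp (by fun_prop : Continuous fun s : ℝ => (s, x))).intervalIntegrable _ _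

lemma K_dual {d p N : ℕ} (A : Matrix (Fin p) (Fin N) ℝ) {r : Fin N → Rd d → ℝ}
    (hr : ∀ i, Nice (r i)) (i j : Fin N) {f g : Rd d → ℝ} (hf : Nice f) (hg : Nice g) :
    ∫ x, g x * conv (Kker A r i j) f x =
      ∑ k, A k i * A k j * ∫ x, conv (r i) g x * conv (r j) f x := by
  have hN := (hr i).refle.conv (hr j)
  have e : ∀ x, conv (Kker A r i j) f x =
      ∑ k, A k i * A k j * conv (refle (r i)) (conv (r j) f) x := by
    intro x
    rw [← conv_assoc' (hr i).refle (hr j) hf]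
    simp only [conv_apply' _ f]
    simp only [Kker, Finset.sum_mul]
    obtain ⟨C, hC⟩ := hf.2.2
    rw [integral_finsetSum _ fun k _ => ?_]
    · refine Finset.sum_congr rfl fun k _ => ?_
      rw [← integral_const_mul]
      simp only [mul_assoc]
    · simp only [mul_assoc]
      exact ((Nice.integrable_conv hN.2.1 hf.1 hC x).const_mul _).const_mul _
  simp only [e, Finset.mul_sum]
  rw [integral_finsetSum _ fun k _ => ?_]
  · refine Finset.sum_congr rfl fun k _ => ?_
    rw [← conv_adj (hr i) hg ((hr j).conv hf), ← integral_const_mul]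
    congr 1; funext x; ring
  · have := (hg.mul ((hr i).refle.conv ((hr j).conv hf))).const_mul (A k i * A k j)
    refine this.congr (ae_of_all _ fun x => ?_)
    simp only; ring

lemma quad {d N : ℕ} (c : Fin N → ℝ) {W : Fin N → Fin d → Rd d → ℝ} (hW : ∀ i m, Nice (W i m)) :
    ∫ x, ∑ m, (∑ i, c i * W i m x) ^ 2 =
      ∑ m, ∑ i, ∑ j, c i * c j * ∫ x, W i m x * W j m x := by
  have hint : ∀ m i j, Integrable (fun x => c i * c j * (W i m x * W j m x)) := fun m i j =>
    ((hW i m).mul (hW j m)).const_mul _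
  have e : ∀ x, ∑ m, (∑ i, c i * W i m x) ^ 2 =
      ∑ m, ∑ i, ∑ j, c i * c j * (W i m x * W j m x) := by
    intro x
    refine Finset.sum_congr rfl fun m _ => ?_
    rw [sq, Finset.sum_mul_sum]
    refine Finset.sum_congr rfl fun i _ => Finset.sum_congr rfl fun j _ => by ring
  simp only [e]
  rw [integral_finsetSum _ fun m _ => integrable_finsetSum _ fun i _ =>
    integrable_finsetSum _ fun j _ => hint m i j]
  refine Finset.sum_congr rfl fun m _ => ?_
  rw [integral_finsetSum _ fun i _ => integrable_finsetSum _ fun j _ => hint m i j]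
  refine Finset.sum_congr rfl fun i _ => ?_
  rw [integral_finsetSum _ fun j _ => hint m i j]
  refine Finset.sum_congr rfl fun j _ => ?_
  rw [integral_const_mul]

lemma UB.nice_pd {d : ℕ} {T M : ℝ} {u : ℝ → Rd d → ℝ} (h : UB T M u) {t : ℝ}
    (ht : t ∈ Icc 0 T) (hs : ContDiff ℝ 2 (u t)) (m : Fin d) : Nice (pd m (u t)) := by
  have hc := (pd_contDiff m hs).continuous
  refine ⟨hc, ((Bw_int d).const_mul M).mono' hc.aestronglyMeasurable (ae_of_all _ fun x =>
    (pd_bound m _ x).trans (h.b4 t ht x)), M, fun x => (pd_bound m _ x).trans (h.b2 t ht x)⟩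

lemma Q_eq {d N : ℕ} {T M : ℝ} {u : Fin N → ℝ → Rd d → ℝ} (h : ∀ i, UB T M (u i)) {t : ℝ}
    (ht : t ∈ Icc 0 T) (hs : ∀ i, ContDiff ℝ 2 (u i t)) (c : Fin N → ℝ)
    {r : Fin N → Rd d → ℝ} (hr : ∀ i, Nice (r i)) (x : Rd d) :
    ‖∑ i : Fin N, c i • gradient (conv (r i) (u i t)) x‖ ^ 2 =
      ∑ m, (∑ i, c i * conv (r i) (pd m (u i t)) x) ^ 2 := by
  rw [EuclideanSpace.norm_sq_eq]
  refine Finset.sum_congr rfl fun m _ => ?_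
  rw [Real.norm_eq_abs, sq_abs]
  congr 1
  rw [WithLp.ofLp_sum, Finset.sum_apply]
  refine Finset.sum_congr rfl fun i _ => ?_
  rw [PiLp.smul_apply, grad_apply, smul_eq_mul,
    conv_pd (hr i).2.1 ((hs i).of_le (by norm_num)) ((h i).b1 t ht) ((h i).b2 t ht)]

lemma Q_meas {d N : ℕ} {u : Fin N → ℝ → Rd d → ℝ}
    (hU : ∀ i, ContDiff ℝ (⊤ : ℕ∞) (fun q : ℝ × Rd d => u i q.1 q.2)) (c : Fin N → ℝ)
    {r : Fin N → Rd d → ℝ} (hr : ∀ i, Nice (r i)) :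
    StronglyMeasurable (fun s => ∫ x, ∑ m, (∑ i, c i * conv (r i) (pd m (u i s)) x) ^ 2) := by
  have h1 : ∀ i m, StronglyMeasurable (fun q : ℝ × Rd d => conv (r i) (pd m (u i q.1)) q.2) := by
    intro i m
    have : Continuous (fun z : (ℝ × Rd d) × Rd d => r i (z.1.2 - z.2) * pd m (u i z.1.1) z.2) :=
      ((hr i).1.comp (by fun_prop)).mul ((pd_cont (hU i) m).comp
        (by fun_prop : Continuous fun z : (ℝ × Rd d) × Rd d => (z.1.1, z.2)))
    exact this.stronglyMeasurable.integral_prod_right'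
  refine StronglyMeasurable.integral_prod_right'
    (f := fun q : ℝ × Rd d => ∑ m, (∑ i, c i * conv (r i) (pd m (u i q.1)) q.2) ^ 2) ?_
  refine Finset.stronglyMeasurable_fun_sum _ fun m _ => ?_
  exact (Finset.stronglyMeasurable_fun_sum _ fun i _ => (h1 i m).const_mul (c i)).pow 2

section
variable {d p N : ℕ} (A : Matrix (Fin p) (Fin N) ℝ) (r : Fin N → Rd d → ℝ)
  (u : Fin N → ℝ → Rd d → ℝ)

/-- velocity component -/
def Vel (t : ℝ) (i : Fin N) (m : Fin d) (y : Rd d) : ℝ :=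
  ∑ j, conv (Kker A r i j) (pd m (u j t)) y

lemma Vel_facts {T M : ℝ} (h : ∀ i, UB T M (u i)) (hr : ∀ i, Nice (r i)) {t : ℝ}
    (ht : t ∈ Icc 0 T) (hs : ∀ i, ContDiff ℝ 2 (u i t)) (i : Fin N) (m : Fin d) :
    Differentiable ℝ (Vel A r u t i m) ∧
    (∀ x, |Vel A r u t i m x| ≤ ∑ j, (∫ y, |Kker A r i j y|) * M) ∧
    (∀ x, |pd m (Vel A r u t i m) x| ≤ ∑ j, (∫ y, |Kker A r i j y|) * M) := by
  have hK := Nice.Kker A hr i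
  have b1 : ∀ j x, |pd m (u j t) x| ≤ M := fun j x => (pd_bound m _ x).trans ((h j).b2 t ht x)
  have b2 : ∀ j x, ‖fderiv ℝ (pd m (u j t)) x‖ ≤ M := fun j x =>
    (fderiv_pd_bound m (hs j) x).trans ((h j).b3 t ht x)
  have hd : ∀ j, Differentiable ℝ (conv (Kker A r i j) (pd m (u j t))) := fun j x =>
    (conv_hasFDerivAt (hK j).2.1 (pd_contDiff m (hs j)) (b1 j) (b2 j) x).differentiableAt
  refine ⟨?_, ?_, ?_⟩
  · exact Differentiable.fun_sum fun j _ => hd j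
  · intro x
    exact (Finset.abs_sum_le_sum_abs _ _).trans
      (Finset.sum_le_sum fun j _ => conv_bound (hK j).2.1 (b1 j) x)
  · intro x
    have e : pd m (Vel A r u t i m) x = ∑ j, conv (Kker A r i j) (pd m (pd m (u j t))) x := by
      have : pd m (Vel A r u t i m) x = ∑ j, pd m (conv (Kker A r i j) (pd m (u j t))) x := by
        unfold pd Vel
        rw [fderiv_fun_sum fun j _ => hd j x]
        simp; rfl
      rw [this]
      refine Finset.sum_congr rfl fun j _ => ?_
      rw [conv_pd (hK j).2.1 (pd_contDiff m (hs j)) (b1 j) (b2 j)]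
    rw [e]
    exact (Finset.abs_sum_le_sum_abs _ _).trans
      (Finset.sum_le_sum fun j _ => conv_bound (hK j).2.1
        (fun x => (pd_bound m _ x).trans (b2 j x)) x)

lemma sdiv_eq {T M : ℝ} (h : ∀ i, UB T M (u i)) (hr : ∀ i, Nice (r i)) {t : ℝ}
    (ht : t ∈ Icc 0 T) (hs : ∀ i, ContDiff ℝ 2 (u i t)) (i : Fin N) (x : Rd d) :
    sdiv (fun y => u i t y • ∑ j : Fin N, gradient (conv (Kker A r i j) (u j t)) y) x =
      ∑ m, pd m (fun y => u i t y * Vel A r u t i m y) x := by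
  unfold _root_.sdiv
  refine Finset.sum_congr rfl fun m _ => ?_
  rw [pd]
  congr 2
  funext y
  rw [PiLp.smul_apply, smul_eq_mul, WithLp.ofLp_sum, Finset.sum_apply, Vel]
  congr 1
  refine Finset.sum_congr rfl fun j _ => ?_
  rw [grad_apply, conv_pd (Nice.Kker A hr i j).2.1 ((hs j).of_le (by norm_num)) ((h j).b1 t ht)
    ((h j).b2 t ht)]

lemma dissip {T M : ℝ} (h : ∀ i, UB T M (u i)) (hpos : ∀ i t x, 0 < u i t x)
    (hr : ∀ i, Nice (r i)) {t : ℝ}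
    (ht : t ∈ Icc 0 T) (hs : ∀ i, ContDiff ℝ 2 (u i t)) :
    ∑ i, ∫ x, (∑ m, pd m (fun y => u i t y * Vel A r u t i m y) x) * (Real.log (u i t x) + 1) =
      - ∑ k, ∫ x, ∑ m, (∑ i, A k i * conv (r i) (pd m (u i t)) x) ^ 2 := by
  have hn : ∀ i m, Nice (pd m (u i t)) := fun i m => (h i).nice_pd ht (hs i) m
  have e1 : ∀ i, ∫ x, (∑ m, pd m (fun y => u i t y * Vel A r u t i m y) x) *
      (Real.log (u i t x) + 1) = - ∑ m, ∑ j, ∑ k, A k i * A k j *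
        ∫ x, conv (r i) (pd m (u i t)) x * conv (r j) (pd m (u j t)) x := by
    intro i
    have hb := fun m => ibp (h i) ht (hpos i) (hs i) m (Vel_facts A r u h hr ht hs i m).1
      (Vel_facts A r u h hr ht hs i m).2.1 (Vel_facts A r u h hr ht hs i m).2.2
    simp only [Finset.sum_mul]
    rw [integral_finsetSum _ fun m _ => (hb m).1, ← Finset.sum_neg_distrib]
    refine Finset.sum_congr rfl fun m _ => ?_
    rw [(hb m).2]
    congr 1
    simp only [Vel, Finset.mul_sum]
    rw [integral_finsetSum _ fun j _ => (hn i m).mul ((Nice.Kker A hr i j).conv (hn j m))]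
    exact Finset.sum_congr rfl fun j _ => K_dual A hr i j (hn j m) (hn i m)
  have e2 := fun k => quad (A k) (W := fun i m => conv (r i) (pd m (u i t)))
    fun i m => (hr i).conv (hn i m)
  simp only [e1, e2, Finset.sum_neg_distrib]
  congr 1
  rw [Finset.sum_comm]
  conv_rhs => rw [Finset.sum_comm]
  refine Finset.sum_congr rfl fun m _ => ?_
  conv_rhs => rw [Finset.sum_comm]
  refine Finset.sum_congr rfl fun i _ => ?_
  rw [Finset.sum_comm]

end

/-- Entropy dissipation identity for the multi-species nonlocal system. -/
theorem entropy_dissipation_multi_species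
    (d : ℕ) (hd : 2 ≤ d) (T ε : ℝ) (hT : 0 < T) (hε : 0 < ε)
    (N p : ℕ) (hN : 0 < N) (hNp : N ≤ p)
    (A : Matrix (Fin p) (Fin N) ℝ)
    (ρ : Fin N → Rd d → ℝ)
    (hρS : ∀ i, ∃ S : SchwartzMap (Rd d) ℝ, ⇑S = ρ i)
    (hρpos : ∀ i x, 0 ≤ ρ i x) (hρint : ∀ i, ∫ x, ρ i x = 1)
    (u : Fin N → ℝ → Rd d → ℝ) (hupos : ∀ i t x, 0 < u i t x)
    (husmooth : ∀ i, ContDiff ℝ (⊤ : ℕ∞) (fun q : ℝ × Rd d => u i q.1 q.2))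
    (huS : ∀ i, SchwartzUnif T (u i))
    (huent : ∀ i, ∀ t ∈ Icc (0:ℝ) T, Integrable (fun x => u i t x * Real.log (u i t x)))
    (humom : ∀ i, ∀ t ∈ Icc (0:ℝ) T, Integrable (fun x : Rd d => ‖x‖ ^ 2 * u i t x))
    (hpde : ∀ i, ∀ t ∈ Icc (0:ℝ) T, ∀ x, deriv (fun s => u i s x) t
      = sdiv (fun y => u i t y • ∑ j : Fin N,
          gradient (conv (Kker A (fun l => resc ε (ρ l)) i j) (u j t)) y) x) :
    ∀ t ∈ Icc (0:ℝ) T,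
      (∑ i : Fin N, ∫ x, u i t x * Real.log (u i t x))
        + ∑ k : Fin p, ∫ s in (0:ℝ)..t, ∫ x,
            ‖∑ i : Fin N, A k i • gradient (conv (resc ε (ρ i)) (u i s)) x‖ ^ 2
      = ∑ i : Fin N, ∫ x, u i 0 x * Real.log (u i 0 x) := by
  choose S hS using hρS
  set r : Fin N → Rd d → ℝ := fun l => resc ε (ρ l) with hrdef
  have hr : ∀ i, Nice (r i) := fun i => by
    have := Nice.resc hε (S i)
    rwa [hS i] at this
  have hs : ∀ i t, ContDiff ℝ 2 (u i t) := fun i t => slice_contDiff (husmooth i) t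
  choose M0 hM0 using fun i => exists_UB (huS i) (hupos i) (hs i)
  set M : ℝ := ∑ i, M0 i with hMdef
  have h : ∀ i, UB T M (u i) := fun i => (hM0 i).mono
    (Finset.single_le_sum (f := M0) (fun j _ => zero_le_one.trans (hM0 j).one_le)
      (Finset.mem_univ i))
  have hpde' : ∀ i, ∀ t ∈ Icc (0:ℝ) T, ∀ x, deriv (fun s => u i s x) t =
      ∑ m, pd m (fun y => u i t y * Vel A r u t i m y) x := fun i t ht x => by
    rw [hpde i t ht x]
    exact sdiv_eq A r u h hr ht (fun i => hs i t) i x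
  have hb : ∀ i, ∃ C, ∀ t ∈ Icc (0:ℝ) T, ∀ x,
      |deriv (fun s => u i s x) t * (Real.log (u i t x) + 1)| ≤ C * Bw d x := by
    intro i
    have hM1 := (h i).one_le
    set C : ℝ := ∑ j, (∫ y, |Kker A r i j y|) * M with hC
    have hC0 : 0 ≤ C := Finset.sum_nonneg fun j _ =>
      mul_nonneg (integral_nonneg fun y => abs_nonneg _) (by linarith)
    refine ⟨(d * (2 * M * C)) * M, fun t ht x => log_dom (h i) ht (by positivity) ?_⟩
    rw [hpde' i t ht x]
    refine (Finset.abs_sum_le_sum_abs _ _).trans ?_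
    have := Finset.sum_le_sum (s := (Finset.univ : Finset (Fin d))) fun m _ =>
      pd_mul_bound (h i) ht (hupos i) (hs i t) m (Vel_facts A r u h hr ht (fun i => hs i t) i m).1
      (Vel_facts A r u h hr ht (fun i => hs i t) i m).2.1
      (Vel_facts A r u h hr ht (fun i => hs i t) i m).2.2 x
    refine this.trans (le_of_eq ?_)
    rw [Finset.sum_const, Finset.card_univ, Fintype.card_fin, nsmul_eq_mul]
    ring
  choose C hC using hb
  intro t ht
  have htime := fun i => time_id (husmooth i) (hupos i) (hC i) (huent i) ht
  -- the dissipation densities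
  set Q : Fin p → ℝ → ℝ := fun k s =>
    ∫ x, ∑ m, (∑ i, A k i * conv (r i) (pd m (u i s)) x) ^ 2 with hQ
  have hQ0 : ∀ k s, 0 ≤ Q k s := fun k s =>
    integral_nonneg fun x => Finset.sum_nonneg fun m _ => sq_nonneg _
  have hsub : ∀ s ∈ Ioc (0:ℝ) t, s ∈ Icc (0:ℝ) T := fun s hs => ⟨hs.1.le, hs.2.trans ht.2⟩
  have hdis : ∀ s ∈ Icc (0:ℝ) T,
      ∑ i, ∫ x, deriv (fun s => u i s x) s * (Real.log (u i s x) + 1) = - ∑ k, Q k s := by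
    intro s hs'
    rw [← dissip A r u h hupos hr hs' fun i => hs i s]
    refine Finset.sum_congr rfl fun i _ => ?_
    congr 1; funext x
    rw [hpde' i s hs' x]
  have hsumInt : IntervalIntegrable (fun s => ∑ i, ∫ x, deriv (fun s => u i s x) s *
      (Real.log (u i s x) + 1)) volume 0 t :=
    by
      have := IntervalIntegrable.sum Finset.univ fun i _ => (htime i).1
      refine IntervalIntegrable.congr (fun s _ => ?_) this
      simp
  have hQint : ∀ k, IntervalIntegrable (Q k) volume 0 t := by
    intro k
    rw [intervalIntegrable_iff_integrableOn_Ioc_of_le ht.1] at hsumInt ⊢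
    refine Integrable.mono' hsumInt.neg (Q_meas husmooth (A k) hr).aestronglyMeasurable ?_
    filter_upwards [ae_restrict_mem measurableSet_Ioc] with s hs'
    rw [Real.norm_eq_abs, abs_of_nonneg (hQ0 k s), Pi.neg_apply, hdis s (hsub s hs'), neg_neg]
    exact Finset.single_le_sum (f := fun k => Q k s) (fun j _ => hQ0 j s) (Finset.mem_univ k)
  have e1 : ∀ k, (∫ s in (0:ℝ)..t, ∫ x,
      ‖∑ i : Fin N, A k i • gradient (conv (r i) (u i s)) x‖ ^ 2) = ∫ s in (0:ℝ)..t, Q k s := by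
    intro k
    rw [intervalIntegral.integral_of_le ht.1, intervalIntegral.integral_of_le ht.1]
    refine setIntegral_congr_fun measurableSet_Ioc fun s hs' => ?_
    simp only [hQ]
    congr 1; funext x
    exact Q_eq h (hsub s hs') (fun i => hs i s) (A k) hr x
  have e2 : ∑ k, (∫ s in (0:ℝ)..t, Q k s) =
      - ∑ i, ∫ s in (0:ℝ)..t, ∫ x, deriv (fun s => u i s x) s * (Real.log (u i s x) + 1) := by
    rw [← intervalIntegral.integral_finsetSum fun k _ => hQint k,
      ← intervalIntegral.integral_finsetSum fun i _ => (htime i).1,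
      ← intervalIntegral.integral_neg,
      intervalIntegral.integral_of_le ht.1, intervalIntegral.integral_of_le ht.1]
    refine setIntegral_congr_fun measurableSet_Ioc fun s hs' => ?_
    rw [hdis s (hsub s hs'), neg_neg]
  have e3 : ∑ i, ((∫ x, u i t x * Real.log (u i t x)) - ∫ x, u i 0 x * Real.log (u i 0 x)) =
      ∑ i, ∫ s in (0:ℝ)..t, ∫ x, deriv (fun s => u i s x) s * (Real.log (u i s x) + 1) :=
    Finset.sum_congr rfl fun i _ => (htime i).2
  rw [Finset.sum_sub_distrib] at e3
  have e4 := Finset.sum_congr (s₁ := Finset.univ) rfl fun k _ => e1 k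
  rw [e4, e2]
  linarith
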